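/- arXiv:0709.2490 — 3 statements merged into one kernel-verified Lean document; each statement's English description precedes it below -/
import Mathlib

section
/- Assume Assumption 1. Let y_1, …, y_v be points in the interior of I with J(y_j) = ω₀ for some ω₀ ∈ S^{n-1} (possibly nonregular) and with |DJ(y_j)/Dy| ≠ 0 for each j. Then there exist neighborhoods M_j ⊂ I of y_j, an R > 0, and a constant c > 0, such that: (i) J restricted to M_j is a diffeomorphism from M_j onto J(M_j); and (ii) for every y ∈ M_j and every s with |x_s(y)| > R, the map (y,s) ↦ x_s(y) is a local diffeomorphism at (y,s), and its absolute Jacobian determinant |D(x)/D(y,s)| satisfies |D(x)/D(y,s)| ≥ c. -/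
open MeasureTheory Filter Topology Metric
open scoped RealInnerProductSpace

/-- The absolute Jacobian determinant `√det(DJ(y)ᵀ DJ(y))` of a map
`J : ℝ^m → ℝ^n` at a point `y` (computed via the Gram determinant of the images of the
standard basis vectors, which agrees with the Jacobian in local coordinates on `S^{n-1}`
for sphere-valued maps). -/
noncomputable def absJac {m n : ℕ}
    (J : EuclideanSpace ℝ (Fin m) → EuclideanSpace ℝ (Fin n))
    (y : EuclideanSpace ℝ (Fin m)) : ℝ :=
  Real.sqrt (Matrix.det (Matrix.of fun i j : Fin m =>
    ⟪fderiv ℝ J y (EuclideanSpace.single i (1 : ℝ)),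
      fderiv ℝ J y (EuclideanSpace.single j (1 : ℝ))⟫))

/-- The absolute Jacobian determinant `|D(x)/D(y,s)|` of a map
`Φ : ℝ^m × ℝ → ℝ^n` at a point, computed via the Gram determinant of the images of the
standard basis vectors of `ℝ^m × ℝ`. -/
noncomputable def absJacP {m n : ℕ}
    (Φ : EuclideanSpace ℝ (Fin m) × ℝ → EuclideanSpace ℝ (Fin n))
    (z : EuclideanSpace ℝ (Fin m) × ℝ) : ℝ :=
  Real.sqrt (Matrix.det (Matrix.of fun i j : Fin m ⊕ Unit =>
    ⟪fderiv ℝ Φ z (Sum.elim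
        (fun i' => ((EuclideanSpace.single i' (1 : ℝ) : EuclideanSpace ℝ (Fin m)), (0 : ℝ)))
        (fun _ => ((0 : EuclideanSpace ℝ (Fin m)), (1 : ℝ))) i),
      fderiv ℝ Φ z (Sum.elim
        (fun i' => ((EuclideanSpace.single i' (1 : ℝ) : EuclideanSpace ℝ (Fin m)), (0 : ℝ)))
        (fun _ => ((0 : EuclideanSpace ℝ (Fin m)), (1 : ℝ))) j)⟫))


section
variable {E F : Type*} [NormedAddCommGroup E] [NormedSpace ℝ E]
  [NormedAddCommGroup F] [NormedSpace ℝ F]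

theorem secdiff_iter {f : E → F} {C : ℝ} (hC : 0 ≤ C)
    (h : ∀ y v w, ‖f (y + v + w) - f (y + v) - f (y + w) + f y‖ ≤ C * ‖v‖ * ‖w‖)
    (y v : E) (N : ℕ) :
    ‖f (y + (N : ℝ) • v) - f y - (N : ℝ) • (f (y + v) - f y)‖ ≤ C * (N : ℝ) ^ 2 * ‖v‖ ^ 2 := by
  induction N with
  | zero => simp
  | succ N ih =>
    have h1 := h y ((N : ℝ) • v) v
    have e : f (y + ((N + 1 : ℕ) : ℝ) • v) - f y - ((N + 1 : ℕ) : ℝ) • (f (y + v) - f y)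
        = (f (y + (N : ℝ) • v) - f y - (N : ℝ) • (f (y + v) - f y)) +
          (f (y + (N : ℝ) • v + v) - f (y + (N : ℝ) • v) - f (y + v) + f y) := by
      have : y + ((N + 1 : ℕ) : ℝ) • v = y + (N : ℝ) • v + v := by push_cast; module
      rw [this]; push_cast; module
    rw [e]
    refine (norm_add_le _ _).trans ((add_le_add ih h1).trans ?_)
    rw [norm_smul, Real.norm_of_nonneg (Nat.cast_nonneg N)]
    push_cast
    have : 0 ≤ C * ‖v‖ ^ 2 * (N + 1 : ℝ) := by positivity
    nlinarith [this]

theorem secdiff_lin {f : E → F} {C : ℝ} (hC : 0 ≤ C)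
    (h : ∀ y v w, ‖f (y + v + w) - f (y + v) - f (y + w) + f y‖ ≤ C * ‖v‖ * ‖w‖)
    {y : E} {L : E →L[ℝ] F} (hL : HasFDerivAt f L y) (v : E) :
    ‖f (y + v) - f y - L v‖ ≤ C * ‖v‖ ^ 2 := by
  have hc : Tendsto (fun n : ℕ => ‖((n : ℝ) + 1)‖) atTop atTop := by
    refine tendsto_norm_atTop_atTop.comp ?_
    exact tendsto_atTop_add_const_right _ _ tendsto_natCast_atTop_atTop
  have hl := hL.lim v hc
  have hl2 := (tendsto_const_nhds (x := f (y + v) - f y)).sub hl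
  refine le_of_tendsto hl2.norm (Eventually.of_forall fun n => ?_)
  have := secdiff_iter hC h y (((n : ℝ) + 1)⁻¹ • v) (n + 1)
  have hn : (n : ℝ) + 1 ≠ 0 := by positivity
  push_cast at this
  rw [smul_smul, mul_inv_cancel₀ hn, one_smul] at this
  refine this.trans (le_of_eq ?_)
  rw [norm_smul, norm_inv, Real.norm_of_nonneg (by positivity : (0 : ℝ) ≤ n + 1)]
  field_simp

theorem secdiff_fderiv_lip {f : E → F} {C : ℝ} (hC : 0 ≤ C)
    (h : ∀ y v w, ‖f (y + v + w) - f (y + v) - f (y + w) + f y‖ ≤ C * ‖v‖ * ‖w‖)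
    {y y' : E} {L L' : E →L[ℝ] F} (hL : HasFDerivAt f L y) (hL' : HasFDerivAt f L' y') :
    ‖L - L'‖ ≤ C * ‖y - y'‖ := by
  refine ContinuousLinearMap.opNorm_le_bound _ (by positivity) fun v => ?_
  have hc : Tendsto (fun n : ℕ => ‖((n : ℝ) + 1)‖) atTop atTop := by
    refine tendsto_norm_atTop_atTop.comp ?_
    exact tendsto_atTop_add_const_right _ _ tendsto_natCast_atTop_atTop
  have hl := (hL.lim v hc).sub (hL'.lim v hc)
  refine le_of_tendsto hl.norm (Eventually.of_forall fun n => ?_)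
  have hn : (n : ℝ) + 1 ≠ 0 := by positivity
  have := h y' (y - y') (((n : ℝ) + 1)⁻¹ • v)
  rw [← smul_sub, norm_smul]
  have e : f (y + ((n : ℝ) + 1)⁻¹ • v) - f y - (f (y' + ((n : ℝ) + 1)⁻¹ • v) - f y') =
    f (y' + (y - y') + ((n : ℝ) + 1)⁻¹ • v) - f (y' + (y - y')) - f (y' + ((n : ℝ) + 1)⁻¹ • v) + f y' := by
    have : y' + (y - y') = y := by abel
    rw [this]; abel
  rw [e]
  refine (mul_le_mul_of_nonneg_left this (norm_nonneg _)).trans (le_of_eq ?_)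
  rw [norm_smul, norm_inv]
  have : ‖(n : ℝ) + 1‖ ≠ 0 := by simpa using hn
  field_simp

theorem contDiff_one_of_secdiff [FiniteDimensional ℝ E] [FiniteDimensional ℝ F]
    [MeasurableSpace E] [BorelSpace E]
    {f : E → F} {C : ℝ} {K : NNReal} (hC : 0 ≤ C) (hK : LipschitzWith K f)
    (h : ∀ y v w, ‖f (y + v + w) - f (y + v) - f (y + w) + f y‖ ≤ C * ‖v‖ * ‖w‖) :
    ContDiff ℝ 1 f := by
  have hd : Dense {x | DifferentiableAt ℝ f x} :=
    Measure.dense_of_ae (hK.ae_differentiableAt (μ := (Measure.addHaar : Measure E)))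
  have hdiff : Differentiable ℝ f := by
    intro y
    obtain ⟨u, hu, hlim⟩ := mem_closure_iff_seq_limit.1 (hd y)
    have hcau : CauchySeq fun k => fderiv ℝ f (u k) := by
      rw [Metric.cauchySeq_iff]
      intro ε hε
      obtain ⟨N, hN⟩ := Metric.cauchySeq_iff.1 hlim.cauchySeq (ε / (C + 1)) (by positivity)
      refine ⟨N, fun m hm n hn => ?_⟩
      have h1 := secdiff_fderiv_lip hC h (hu m).hasFDerivAt (hu n).hasFDerivAt
      have h2 := hN m hm n hn
      rw [dist_eq_norm] at h2 ⊢
      rw [lt_div_iff₀ (by positivity)] at h2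
      nlinarith [norm_nonneg (u m - u n)]
    obtain ⟨L, hL⟩ := cauchySeq_tendsto_of_complete hcau
    have hb : ∀ v, ‖f (y + v) - f y - L v‖ ≤ C * ‖v‖ ^ 2 := by
      intro v
      have hf := hK.continuous
      have t1 : Tendsto (fun k => f (u k + v) - f (u k) - fderiv ℝ f (u k) v) atTop
          (𝓝 (f (y + v) - f y - L v)) := by
        refine Tendsto.sub (Tendsto.sub ?_ ?_) ?_
        · exact (hf.tendsto _).comp (hlim.add_const v)
        · exact (hf.tendsto _).comp hlim
        · exact ((ContinuousLinearMap.apply ℝ F v).continuous.tendsto _).comp hL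
      exact le_of_tendsto t1.norm (Eventually.of_forall fun k => secdiff_lin hC h (hu k).hasFDerivAt v)
    refine HasFDerivAt.differentiableAt (f' := L) ?_
    rw [hasFDerivAt_iff_isLittleO_nhds_zero]
    have : (fun v : E => f (y + v) - f y - L v) =O[𝓝 0] fun v => ‖v‖ ^ 2 :=
      Asymptotics.IsBigO.of_bound C (Eventually.of_forall fun v => by simpa using hb v)
    refine this.trans_isLittleO ?_
    exact Asymptotics.isLittleO_norm_pow_id one_lt_two
  rw [contDiff_one_iff_fderiv]
  refine ⟨hdiff, (LipschitzWith.of_dist_le_mul (K := ⟨C, hC⟩) fun x y => ?_).continuous⟩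
  rw [dist_eq_norm, dist_eq_norm]
  exact secdiff_fderiv_lip hC h (hdiff x).hasFDerivAt (hdiff y).hasFDerivAt
end


section
variable {Y W : Type*} [NormedAddCommGroup Y] [NormedSpace ℝ Y]
  [NormedAddCommGroup W] [NormedSpace ℝ W]

theorem flow_lip {F : W → W} {K : ℝ} (hK : 0 < K)
    (hF1 : ∀ z z', ‖F z - F z'‖ ≤ K * ‖z - z'‖)
    {Z : Y → ℝ → W} (hZ : ∀ y t, HasDerivAt (Z y) (F (Z y t)) t)
    (hZ0 : ∀ y y', ‖Z y 0 - Z y' 0‖ ≤ ‖y - y'‖) {S : ℝ} (y y' : Y) {s : ℝ} (hs : s ∈ Set.Icc 0 S) :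
    ‖Z y s - Z y' s‖ ≤ Real.exp (K * S) * ‖y - y'‖ := by
  have hd : ∀ t, HasDerivAt (fun t => Z y t - Z y' t) (F (Z y t) - F (Z y' t)) t :=
    fun t => (hZ y t).sub (hZ y' t)
  have := norm_le_gronwallBound_of_norm_deriv_right_le (f := fun t => Z y t - Z y' t)
    (f' := fun t => F (Z y t) - F (Z y' t)) (δ := ‖y - y'‖) (K := K) (ε := 0) (a := 0) (b := S)
    (fun t _ => (hd t).continuousAt.continuousWithinAt)
    (fun t _ => (hd t).hasDerivWithinAt) (hZ0 y y') (fun t _ => by simpa using hF1 _ _) s hs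
  rw [gronwallBound_ε0, sub_zero, mul_comm] at this
  refine this.trans (mul_le_mul_of_nonneg_right ?_ (norm_nonneg _))
  exact Real.exp_le_exp.2 (mul_le_mul_of_nonneg_left hs.2 hK.le)

theorem flow_secdiff {F : W → W} {K M : ℝ} (hK : 0 < K) (hM : 0 ≤ M)
    (hF1 : ∀ z z', ‖F z - F z'‖ ≤ K * ‖z - z'‖)
    (hF2 : ∀ p a b, ‖F (p + a + b) - F (p + a) - F (p + b) + F p‖ ≤ M * ‖a‖ * ‖b‖)
    {Z : Y → ℝ → W} (hZ : ∀ y t, HasDerivAt (Z y) (F (Z y t)) t)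
    (A : Y →ₗ[ℝ] W) (hA : ∀ v, ‖A v‖ ≤ ‖v‖) (b : W) (hZ0 : ∀ y, Z y 0 = A y + b) 
    {S : ℝ} (hS : 0 ≤ S) :
    ∃ C, 0 ≤ C ∧ ∀ y v w, 
      ‖Z (y + v + w) S - Z (y + v) S - Z (y + w) S + Z y S‖ ≤ C * ‖v‖ * ‖w‖ := by
  have hlip : ∀ y y' s, s ∈ Set.Icc 0 S → ‖Z y s - Z y' s‖ ≤ Real.exp (K * S) * ‖y - y'‖ := by
    intro y y' s hs
    refine flow_lip hK hF1 hZ (fun y y' => ?_) y y' hs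
    rw [hZ0, hZ0, add_sub_add_right_eq_sub, ← map_sub]
    exact hA _
  have hexp : 0 ≤ Real.exp (K * S) - 1 := by
    have := Real.one_le_exp (mul_nonneg hK.le hS); linarith
  refine ⟨M * Real.exp (K * S) ^ 2 / K * (Real.exp (K * S) - 1), by positivity, fun y v w => ?_⟩
  have hd : ∀ t, HasDerivAt (fun t => Z (y + v + w) t - Z (y + v) t - Z (y + w) t + Z y t)
      (F (Z (y + v + w) t) - F (Z (y + v) t) - F (Z (y + w) t) + F (Z y t)) t :=
    fun t => (((hZ _ t).sub (hZ _ t)).sub (hZ _ t)).add (hZ _ t)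
  have := norm_le_gronwallBound_of_norm_deriv_right_le 
    (f := fun t => Z (y + v + w) t - Z (y + v) t - Z (y + w) t + Z y t)
    (f' := fun t => F (Z (y + v + w) t) - F (Z (y + v) t) - F (Z (y + w) t) + F (Z y t)) 
    (δ := 0) (K := K) (ε := M * (Real.exp (K * S) * ‖v‖) * (Real.exp (K * S) * ‖w‖)) (a := 0) (b := S)
    (fun t _ => (hd t).continuousAt.continuousWithinAt)
    (fun t _ => (hd t).hasDerivWithinAt) ?_ ?_ S ⟨hS, le_rfl⟩
  · rw [gronwallBound_of_K_ne_0 hK.ne'] at this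
    refine this.trans (le_of_eq ?_)
    simp only [sub_zero]
    ring
  · simp only [hZ0, map_add]
    rw [show A y + A v + A w + b - (A y + A v + b) - (A y + A w + b) + (A y + b) = 0 by abel]
    simp
  · intro t ht
    have ht' := Set.Ico_subset_Icc_self ht
    set z1 := Z (y + v + w) t
    set z2 := Z (y + v) t
    set z3 := Z (y + w) t
    set z4 := Z y t
    have e : F z1 - F z2 - F z3 + F z4 = (F z1 - F (z4 + (z2 - z4) + (z3 - z4))) + 
      (F (z4 + (z2 - z4) + (z3 - z4)) - F (z4 + (z2 - z4)) - F (z4 + (z3 - z4)) + F z4) := by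
      rw [show z4 + (z2 - z4) = z2 by abel, show z4 + (z3 - z4) = z3 by abel]; abel
    rw [e]
    refine (norm_add_le _ _).trans (add_le_add ((hF1 _ _).trans (le_of_eq ?_)) ((hF2 _ _ _).trans ?_))
    · congr 2; abel
    · have a1 : ‖z2 - z4‖ ≤ _ := hlip (y + v) y t ht'
      have a2 : ‖z3 - z4‖ ≤ _ := hlip (y + w) y t ht'
      rw [add_sub_cancel_left] at a1 a2
      gcongr

end

section
variable {E : Type*} [NormedAddCommGroup E] [NormedSpace ℝ E]

theorem smooth_cpt_secdiff {g : E → E} (hg : ContDiff ℝ (⊤ : ℕ∞) g) (hc : HasCompactSupport g) :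
    (∃ K : NNReal, LipschitzWith K g) ∧ ∃ M : ℝ, 0 ≤ M ∧
     ∀ p a b, ‖g (p + a + b) - g (p + a) - g (p + b) + g p‖ ≤ M * ‖a‖ * ‖b‖ := by
  refine ⟨?_, ?_⟩
  · exact ⟨_, (ContDiff.lipschitzWith_of_hasCompactSupport hc hg (by simp)).choose_spec⟩
  · obtain ⟨M, hM⟩ := ContDiff.lipschitzWith_of_hasCompactSupport (hc.fderiv ℝ)
      (hg.fderiv_right (m := (⊤ : ℕ∞)) (by simp)) (by simp)
    refine ⟨M, M.2, fun p a b => ?_⟩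
    have hgd : Differentiable ℝ g := hg.differentiable (by simp)
    have := Convex.norm_image_sub_le_of_norm_fderiv_le (𝕜 := ℝ) (f := fun x => g (x + a) - g x)
      (s := Set.univ) (C := M * ‖a‖) (x := p) (y := p + b) (fun x _ => by fun_prop) ?_ convex_univ
      (Set.mem_univ _) (Set.mem_univ _)
    · refine le_trans (le_of_eq ?_) (this.trans (le_of_eq ?_))
      · rw [add_right_comm]; congr 1; abel
      · simp
    · intro x _
      rw [fderiv_fun_sub (by fun_prop) (by fun_prop), fderiv_comp_add_right, ← dist_eq_norm]
      refine (hM.dist_le_mul _ _).trans (le_of_eq ?_)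
      simp [dist_eq_norm]
end

section
variable {m n : ℕ}
theorem gradient_contDiff {q : EuclideanSpace ℝ (Fin n) → ℝ} (hq : ContDiff ℝ (⊤ : ℕ∞) q) :
    ContDiff ℝ (⊤ : ℕ∞) (gradient q) := by
  unfold gradient
  exact ((InnerProductSpace.toDual ℝ (EuclideanSpace ℝ (Fin n))).symm.contDiff).comp 
    (hq.fderiv_right (m := (⊤ : ℕ∞)) (by simp))

theorem gradient_zero_of_notMem {q : EuclideanSpace ℝ (Fin n) → ℝ} {x} (hx : x ∉ tsupport q) :
    gradient q x = 0 := by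
  unfold gradient
  have : fderiv ℝ q x = 0 := by
    by_contra h
    exact hx (support_fderiv_subset ℝ h)
  simp [this]

theorem gradient_cpt {q : EuclideanSpace ℝ (Fin n) → ℝ} (hc : HasCompactSupport q) :
    HasCompactSupport (gradient q) :=
  HasCompactSupport.intro hc fun _ hx => gradient_zero_of_notMem hx

end

section
variable {m n : ℕ}

theorem absJac_eq (J : EuclideanSpace ℝ (Fin m) → EuclideanSpace ℝ (Fin n))
    (y : EuclideanSpace ℝ (Fin m)) :
    absJac J y = Real.sqrt (Matrix.det (Matrix.gram ℝ
      fun i => fderiv ℝ J y (EuclideanSpace.single i (1 : ℝ)))) := rfl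

theorem absJacP_eq (Φ : EuclideanSpace ℝ (Fin m) × ℝ → EuclideanSpace ℝ (Fin n))
    (z : EuclideanSpace ℝ (Fin m) × ℝ) :
    absJacP Φ z = Real.sqrt (Matrix.det (Matrix.gram ℝ (Sum.elim
      (fun i : Fin m => fderiv ℝ Φ z (EuclideanSpace.single i (1 : ℝ), 0))
      (fun _ : Unit => fderiv ℝ Φ z (0, 1))))) := by
  unfold absJacP
  congr 2
  ext i j
  rcases i with i | i <;> rcases j with j | j <;> rfl

theorem gram_orth (u : Fin m → EuclideanSpace ℝ (Fin n)) (w : EuclideanSpace ℝ (Fin n))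
    (h : ∀ i, ⟪u i, w⟫ = 0) :
    Matrix.det (Matrix.gram ℝ (Sum.elim u (fun _ : Unit => w))) =
      Matrix.det (Matrix.gram ℝ u) * ‖w‖ ^ 2 := by
  have h' : ∀ i, ⟪w, u i⟫ = 0 := fun i => by rw [real_inner_comm]; exact h i
  have : Matrix.gram ℝ (Sum.elim u (fun _ : Unit => w)) =
      Matrix.fromBlocks (Matrix.gram ℝ u) 0 0 (Matrix.of fun _ _ : Unit => ‖w‖ ^ 2) := by
    ext i j
    rcases i with i | i <;> rcases j with j | j <;>
      simp [Matrix.gram_apply, h, h']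
  rw [this, Matrix.det_fromBlocks_zero₂₁]
  simp

theorem gram_scale {ι : Type*} [Fintype ι] [DecidableEq ι] (d : ι → ℝ)
    (u : ι → EuclideanSpace ℝ (Fin n)) :
    Matrix.det (Matrix.gram ℝ fun i => d i • u i) =
      (∏ i, d i) ^ 2 * Matrix.det (Matrix.gram ℝ u) := by
  have : (Matrix.gram ℝ fun i => d i • u i) =
      Matrix.diagonal d * Matrix.gram ℝ u * Matrix.diagonal d := by
    ext i j
    simp [Matrix.gram_apply, inner_smul_left, inner_smul_right]
    ring
  rw [this, Matrix.det_mul, Matrix.det_mul, Matrix.det_diagonal]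
  ring

theorem local_diffeo (hn : m + 1 = n)
    (Φ : EuclideanSpace ℝ (Fin m) × ℝ → EuclideanSpace ℝ (Fin n))
    (z : EuclideanSpace ℝ (Fin m) × ℝ) (hΦ : ContDiffAt ℝ 1 Φ z) (h : absJacP Φ z ≠ 0) :
    ∃ U : Set (EuclideanSpace ℝ (Fin m) × ℝ), IsOpen U ∧ z ∈ U ∧
          Set.InjOn Φ U ∧ IsOpen (Φ '' U) := by
  rw [absJacP_eq] at h
  have h2 := Matrix.linearIndependent_of_det_gram_ne_zero (fun h0 => h (by rw [h0]; simp))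
  have hinj : Function.Injective (fderiv ℝ Φ z) := by
    rw [injective_iff_map_eq_zero]
    rintro ⟨v, t⟩ hv
    have := Fintype.linearIndependent_iff.1 h2 (Sum.elim (fun i => v i) (fun _ => t)) ?_
    · have h1 : v = 0 := by ext i; exact this (Sum.inl i)
      have h3 : t = 0 := this (Sum.inr ())
      rw [h1, h3]; rfl
    · rw [Fintype.sum_sum_type]
      simp only [Sum.elim_inl, Sum.elim_inr, ← map_smul, ← map_sum, ← map_add]
      rw [← hv]
      congr 1
      ext i
      · simp [Prod.fst_sum, Pi.single_apply]
      · simp [Prod.snd_sum]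
  have hfr : Module.finrank ℝ (EuclideanSpace ℝ (Fin m) × ℝ) =
      Module.finrank ℝ (EuclideanSpace ℝ (Fin n)) := by simp [hn]
  let e : (EuclideanSpace ℝ (Fin m) × ℝ) ≃L[ℝ] EuclideanSpace ℝ (Fin n) :=
    (LinearEquiv.ofInjectiveOfFinrankEq (fderiv ℝ Φ z : _ →ₗ[ℝ] _) hinj hfr).toContinuousLinearEquiv
  have he : HasStrictFDerivAt Φ (e : _ →L[ℝ] _) z := by
    have := hΦ.hasStrictFDerivAt (by simp)
    have hee : (e : _ →L[ℝ] _) = fderiv ℝ Φ z := ContinuousLinearMap.ext fun v => rfl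
    rw [hee]
    exact this
  let R := he.toOpenPartialHomeomorph Φ
  refine ⟨R.source, R.open_source, he.mem_toOpenPartialHomeomorph_source, R.injOn, ?_⟩
  have : Φ '' R.source = R.target := R.image_source_eq_target
  rw [this]
  exact R.open_target

theorem local_inv (J : EuclideanSpace ℝ (Fin m) → EuclideanSpace ℝ (Fin n))
    (hJ : ContDiff ℝ (⊤ : ℕ∞) J) (y : EuclideanSpace ℝ (Fin m)) (h : absJac J y ≠ 0) :
    ∃ N : Set (EuclideanSpace ℝ (Fin m)), IsOpen N ∧ y ∈ N ∧
      ∃ Jinv : EuclideanSpace ℝ (Fin n) → EuclideanSpace ℝ (Fin m),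
          (∀ z ∈ N, Jinv (J z) = z) ∧ ContDiffOn ℝ (⊤ : ℕ∞) Jinv (J '' N) := by
  rw [absJac_eq] at h
  have h2 := Matrix.linearIndependent_of_det_gram_ne_zero (fun h0 => h (by rw [h0]; simp))
  have hker : LinearMap.ker (fderiv ℝ J y : EuclideanSpace ℝ (Fin m) →ₗ[ℝ] EuclideanSpace ℝ (Fin n)) = ⊥ := by
    rw [LinearMap.ker_eq_bot, injective_iff_map_eq_zero]
    intro v hv
    have := Fintype.linearIndependent_iff.1 h2 (fun i => v i) ?_
    · ext i; exact this i
    · simp only [← map_smul, ← map_sum]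
      refine Eq.trans ?_ hv
      rw [ContinuousLinearMap.coe_coe]
      congr 1
      ext i
      simp [Pi.single_apply]
  obtain ⟨B0, hB0⟩ := LinearMap.exists_leftInverse_of_injective _ hker
  let B : EuclideanSpace ℝ (Fin n) →L[ℝ] EuclideanSpace ℝ (Fin m) := LinearMap.toContinuousLinearMap B0
  let K := fun z => B (J z)
  have hK : ContDiff ℝ (⊤ : ℕ∞) K := B.contDiff.comp hJ
  have hfK : fderiv ℝ K y = ContinuousLinearMap.id ℝ _ := by
    have : HasFDerivAt K (B.comp (fderiv ℝ J y)) y :=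
      B.hasFDerivAt.comp y (hJ.differentiable (by simp) y).hasFDerivAt
    rw [this.fderiv]
    ext1 v
    exact LinearMap.congr_fun hB0 v
  have hs : HasStrictFDerivAt K ((ContinuousLinearEquiv.refl ℝ (EuclideanSpace ℝ (Fin m)) : _ ≃L[ℝ] _) : _ →L[ℝ] _) y := by
    have := hK.contDiffAt.hasStrictFDerivAt (x := y) (by simp)
    rw [hfK] at this
    exact this
  let R := hs.toOpenPartialHomeomorph K
  have hRK : ∀ z, R z = K z := fun z => rfl
  have hO : IsOpen {z | fderiv ℝ K z ∈ Set.range ((↑) : (EuclideanSpace ℝ (Fin m) ≃L[ℝ] EuclideanSpace ℝ (Fin m)) → _)} :=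
    (ContinuousLinearEquiv.isOpen).preimage (hK.continuous_fderiv (by simp))
  refine ⟨R.source ∩ {z | fderiv ℝ K z ∈ Set.range ((↑) : (EuclideanSpace ℝ (Fin m) ≃L[ℝ] EuclideanSpace ℝ (Fin m)) → _)},
    R.open_source.inter hO, ⟨hs.mem_toOpenPartialHomeomorph_source, ?_⟩, fun x => R.symm (B x), ?_, ?_⟩
  · exact ⟨ContinuousLinearEquiv.refl ℝ _, hfK.symm⟩
  · intro z hz
    exact R.left_inv hz.1
  · rintro _ ⟨z, ⟨hz, e, he⟩, rfl⟩
    have hz' : R.symm (B (J z)) = z := R.left_inv hz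
    have h1 : ContDiffAt ℝ (⊤ : ℕ∞) R.symm (B (J z)) := by
      refine R.contDiffAt_symm (f₀' := e) (R.map_source hz) ?_ ?_
      · rw [hz', he]
        exact (hK.differentiable (by simp) z).hasFDerivAt
      · rw [hz']; exact hK.contDiffAt
    exact (h1.comp (J z) B.contDiff.contDiffAt).contDiffWithinAt
end

section
variable {m n : ℕ}

theorem flow_facts
    (q : EuclideanSpace ℝ (Fin n) → ℝ)
    (hq_smooth : ContDiff ℝ (⊤ : ℕ∞) q) (hq_cpt : HasCompactSupport q)
    (θ₀ : EuclideanSpace ℝ (Fin n)) (hθ₀ : ‖θ₀‖ = 1)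
    (a : ℝ)
    (hsupp : tsupport q ⊆ {x | -a < ⟪x, θ₀⟫} ∩ Metric.ball 0 a)
    (ι : EuclideanSpace ℝ (Fin m) →ₗᵢ[ℝ] EuclideanSpace ℝ (Fin n))
    (hι : ∀ y, ⟪ι y, θ₀⟫ = 0)
    (X P : EuclideanSpace ℝ (Fin m) → ℝ → EuclideanSpace ℝ (Fin n))
    (hX0 : ∀ y, X y 0 = ι y - a • θ₀) (hP0 : ∀ y, P y 0 = θ₀)
    (hX' : ∀ y t, HasDerivAt (X y) ((2 : ℝ) • P y t) t)
    (hP' : ∀ y t, HasDerivAt (P y) (gradient q (X y t)) t)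
    (hA1 : ∀ c : ℝ, ∃ T : ℝ, ∀ y, ∀ s > T, c < ‖X y s‖)
    (J : EuclideanSpace ℝ (Fin m) → EuclideanSpace ℝ (Fin n))
    (hJ : ∀ y, Tendsto (fun t => P y t) atTop (𝓝 (J y))) :
    (∀ y, ∀ s ≤ 0, X y s = ι y + (2 * s - a) • θ₀) ∧
    (∀ S : ℝ, ∃ C : ℝ, ∀ y y', ∀ s ∈ Set.Icc 0 S, ‖X y s - X y' s‖ ≤ C * ‖y - y'‖) ∧
    ∃ T : ℝ, 0 ≤ T ∧ (ContDiff ℝ 1 fun y => X y T) ∧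
      ∀ y, ∀ s ≥ T, X y s = X y T + (2 * (s - T)) • J y := by
  have hz : ∀ x : EuclideanSpace ℝ (Fin n), ¬ (-a < ⟪x, θ₀⟫ ∧ ‖x‖ < a) → gradient q x = 0 := by
    intro x hx
    refine gradient_zero_of_notMem fun h => hx ?_
    have := hsupp h
    exact ⟨this.1, by simpa using this.2⟩
  obtain ⟨⟨Kg, hKg⟩, M, hM, hMb⟩ :=
    smooth_cpt_secdiff (gradient_contDiff hq_smooth) (gradient_cpt hq_cpt)
  let F : EuclideanSpace ℝ (Fin n) × EuclideanSpace ℝ (Fin n) →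
      EuclideanSpace ℝ (Fin n) × EuclideanSpace ℝ (Fin n) := fun z => ((2 : ℝ) • z.2, gradient q z.1)
  let Z : EuclideanSpace ℝ (Fin m) → ℝ → EuclideanSpace ℝ (Fin n) × EuclideanSpace ℝ (Fin n) :=
    fun y t => (X y t, P y t)
  have hZ : ∀ y t, HasDerivAt (Z y) (F (Z y t)) t := fun y t => (hX' y t).prodMk (hP' y t)
  let K : ℝ := max 2 Kg
  have hK : 0 < K := lt_of_lt_of_le two_pos (le_max_left _ _)
  have hF1 : ∀ z z', ‖F z - F z'‖ ≤ K * ‖z - z'‖ := by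
    intro z z'
    rw [Prod.norm_def]
    refine max_le ?_ ?_
    · change ‖(2 : ℝ) • z.2 - (2 : ℝ) • z'.2‖ ≤ _
      rw [← smul_sub, norm_smul]
      refine mul_le_mul ?_ (norm_snd_le (z - z')) (norm_nonneg _) hK.le
      simp [K]
    · change ‖gradient q z.1 - gradient q z'.1‖ ≤ _
      rw [← dist_eq_norm]
      refine (hKg.dist_le_mul _ _).trans ?_
      rw [dist_eq_norm]
      exact mul_le_mul (le_max_right _ _) (norm_fst_le (z - z')) (norm_nonneg _) hK.le
  have hF2 : ∀ p a b, ‖F (p + a + b) - F (p + a) - F (p + b) + F p‖ ≤ M * ‖a‖ * ‖b‖ := by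
    intro p a b
    rw [Prod.norm_def]
    refine max_le ?_ ?_
    · change ‖(2 : ℝ) • (p.2 + a.2 + b.2) - (2 : ℝ) • (p.2 + a.2) - (2 : ℝ) • (p.2 + b.2)
        + (2 : ℝ) • p.2‖ ≤ _
      rw [show (2 : ℝ) • (p.2 + a.2 + b.2) - (2 : ℝ) • (p.2 + a.2) - (2 : ℝ) • (p.2 + b.2)
        + (2 : ℝ) • p.2 = 0 by module, norm_zero]
      positivity
    · refine (hMb p.1 a.1 b.1).trans ?_
      have := norm_fst_le a
      have := norm_fst_le b
      gcongr
  let A : EuclideanSpace ℝ (Fin m) →ₗ[ℝ] EuclideanSpace ℝ (Fin n) × EuclideanSpace ℝ (Fin n) :=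
    (LinearMap.inl ℝ _ _).comp ι.toLinearMap
  have hA : ∀ v, ‖A v‖ ≤ ‖v‖ := by
    intro v
    change ‖(ι v, (0 : EuclideanSpace ℝ (Fin n)))‖ ≤ _
    simp [Prod.norm_def]
  have hZ0 : ∀ y, Z y 0 = A y + (-(a • θ₀), θ₀) := by
    intro y
    change (X y 0, P y 0) = (ι y, (0 : EuclideanSpace ℝ (Fin n))) + (-(a • θ₀), θ₀)
    rw [hX0, hP0, Prod.mk_add_mk, zero_add, sub_eq_add_neg]
  have hZ0' : ∀ y y', ‖Z y 0 - Z y' 0‖ ≤ ‖y - y'‖ := by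
    intro y y'
    rw [hZ0, hZ0, add_sub_add_right_eq_sub, ← map_sub]
    exact hA _
  have hlip : ∀ S : ℝ, ∀ y y', ∀ s ∈ Set.Icc 0 S,
      ‖X y s - X y' s‖ ≤ Real.exp (K * S) * ‖y - y'‖ := fun S y y' s hs =>
    (norm_fst_le (Z y s - Z y' s)).trans (flow_lip hK hF1 hZ hZ0' y y' hs)
  refine ⟨?_, fun S => ⟨_, hlip S⟩, ?_⟩
  · intro y s hs
    have hFl : LipschitzWith ⟨K, hK.le⟩ F := LipschitzWith.of_dist_le_mul fun z z' => by
      rw [dist_eq_norm, dist_eq_norm]; exact hF1 z z'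
    let G : ℝ → EuclideanSpace ℝ (Fin n) × EuclideanSpace ℝ (Fin n) :=
      fun t => (ι y + (2 * t - a) • θ₀, θ₀)
    have hG : ∀ t ≤ 0, HasDerivAt G (F (G t)) t := by
      intro t ht
      have h1 : HasDerivAt (fun t : ℝ => ι y + (2 * t - a) • θ₀) ((2 : ℝ) • θ₀) t := by
        have : HasDerivAt (fun t : ℝ => 2 * t - a) 2 t := by
          simpa using ((hasDerivAt_id t).const_mul 2).sub_const a
        exact (this.smul_const θ₀).const_add _
      have h2 : gradient q (ι y + (2 * t - a) • θ₀) = 0 := by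
        refine hz _ fun h => ?_
        have := h.1
        rw [inner_add_left, hι, inner_smul_left, real_inner_self_eq_norm_sq, hθ₀] at this
        simp at this
        linarith
      have := h1.prodMk (hasDerivAt_const t θ₀)
      change HasDerivAt G ((2 : ℝ) • θ₀, gradient q (ι y + (2 * t - a) • θ₀)) t
      rw [h2]
      exact this
    have := ODE_solution_unique_of_mem_Icc_left (v := fun _ => F) (s := fun _ => Set.univ)
      (K := ⟨K, hK.le⟩) (f := Z y) (g := G) (a := s) (b := 0) (fun _ _ => hFl.lipschitzOnWith)
      (fun t _ => (hZ y t).continuousAt.continuousWithinAt)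
      (fun t _ => (hZ y t).hasDerivWithinAt) (fun _ _ => Set.mem_univ _)
      (fun t ht => (hG t ht.2).continuousAt.continuousWithinAt)
      (fun t ht => (hG t ht.2).hasDerivWithinAt) (fun _ _ => Set.mem_univ _) ?_
    · exact congrArg Prod.fst (this ⟨le_rfl, hs⟩)
    · change (X y 0, P y 0) = (ι y + (2 * 0 - a) • θ₀, θ₀)
      rw [hX0, hP0]
      congr 1
      module
  · obtain ⟨T0, hT0⟩ := hA1 a
    let T := max T0 0 + 1
    have hT : 0 ≤ T := by have := le_max_right T0 0; simp only [T]; linarith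
    have hTT : T0 < T := by have := le_max_left T0 0; simp only [T]; linarith
    have hPc : ∀ y, ∀ s ≥ T, P y s = P y T := by
      intro y s hs
      refine constant_of_has_deriv_right_zero (f := P y) (a := T) (b := s)
        (fun t _ => (hP' y t).continuousAt.continuousWithinAt) (fun t ht => ?_) s ⟨hs, le_rfl⟩
      have h := hP' y t
      rw [hz _ (fun h => lt_asymm h.2 (hT0 y t (lt_of_lt_of_le hTT ht.1)))] at h
      exact h.hasDerivWithinAt
    have hPJ : ∀ y, P y T = J y := fun y =>
      tendsto_nhds_unique (tendsto_const_nhds.congr'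
        ((eventually_ge_atTop T).mono fun s hs => (hPc y s hs).symm)) (hJ y)
    refine ⟨T, hT, ?_, ?_⟩
    · obtain ⟨C, hC, hCb⟩ := flow_secdiff hK hM hF1 hF2 hZ A hA _ hZ0 hT
      refine contDiff_one_of_secdiff (C := C) (K := ⟨Real.exp (K * T), (Real.exp_pos _).le⟩) hC ?_ ?_
      · refine LipschitzWith.of_dist_le_mul fun y y' => ?_
        rw [dist_eq_norm, dist_eq_norm]
        exact hlip T y y' T ⟨hT, le_rfl⟩
      · intro y v w
        exact (norm_fst_le (Z (y + v + w) T - Z (y + v) T - Z (y + w) T + Z y T)).trans (hCb y v w)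
    · intro y s hs
      have := constant_of_has_deriv_right_zero (f := fun s => X y s - (2 * (s - T)) • J y)
        (a := T) (b := s) (fun t _ => ?_) (fun t ht => ?_) s ⟨hs, le_rfl⟩
      · simp only [sub_self, mul_zero, zero_smul, sub_zero] at this
        rw [← this]; abel
      · exact ((hX' y t).continuousAt.sub (by fun_prop)).continuousWithinAt
      · have h1 : HasDerivAt (fun t : ℝ => 2 * (t - T)) 2 t := by
          simpa using ((hasDerivAt_id t).sub_const T).const_mul 2
        have h := (hX' y t).sub (h1.smul_const (J y))
        rw [hPc y t ht.1, hPJ, sub_self] at h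
        exact h.hasDerivWithinAt
end

section
variable {m n : ℕ}

theorem orth_deriv (J : EuclideanSpace ℝ (Fin m) → EuclideanSpace ℝ (Fin n))
    (hJ : ContDiff ℝ (⊤ : ℕ∞) J) (hJnorm : ∀ y, ‖J y‖ = 1) (y v : EuclideanSpace ℝ (Fin m)) :
    ⟪fderiv ℝ J y v, J y⟫ = 0 := by
  have h1 : HasFDerivAt J (fderiv ℝ J y) y := (hJ.differentiable (by simp) y).hasFDerivAt
  have h2 := h1.inner ℝ h1
  have h3 : (fun t => ⟪J t, J t⟫) = fun _ => (1 : ℝ) := by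
    ext t; rw [real_inner_self_eq_norm_sq, hJnorm]; simp
  rw [h3] at h2
  have h4 := h2.unique (hasFDerivAt_const (1 : ℝ) y)
  have h5 := congrArg (fun L => L v) h4
  simp [fderivInnerCLM_apply, real_inner_comm] at h5
  rw [real_inner_comm]
  linarith

theorem far_jac (f J : EuclideanSpace ℝ (Fin m) → EuclideanSpace ℝ (Fin n))
    (hf : ContDiff ℝ 1 f) (hJ : ContDiff ℝ (⊤ : ℕ∞) J) (hJnorm : ∀ y, ‖J y‖ = 1)
    (y : EuclideanSpace ℝ (Fin m)) (h : absJac J y ≠ 0) :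
    ∃ r : ℝ, 0 < r ∧ ∃ S c : ℝ, 0 < c ∧ ∀ z ∈ ball y r, ∀ σ > S,
      c ≤ Real.sqrt (Matrix.det (Matrix.gram ℝ (Sum.elim
        (fun i : Fin m => fderiv ℝ f z (EuclideanSpace.single i (1 : ℝ)) +
            σ • fderiv ℝ J z (EuclideanSpace.single i (1 : ℝ)))
        (fun _ : Unit => (2 : ℝ) • J z)))) := by
  let u : EuclideanSpace ℝ (Fin m) × ℝ → Fin m ⊕ Unit → EuclideanSpace ℝ (Fin n) := fun p =>
    Sum.elim (fun i : Fin m => fderiv ℝ J p.1 (EuclideanSpace.single i (1 : ℝ)) +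
      p.2 • fderiv ℝ f p.1 (EuclideanSpace.single i (1 : ℝ))) (fun _ : Unit => (2 : ℝ) • J p.1)
  let G : EuclideanSpace ℝ (Fin m) × ℝ → ℝ := fun p => Matrix.det (Matrix.gram ℝ (u p))
  have hu : ∀ k, Continuous fun p => u p k := by
    have c1 := hf.continuous_fderiv (by simp)
    have c2 := hJ.continuous_fderiv (by simp)
    have c3 := hJ.continuous
    rintro (i | i)
    · simp only [u, Sum.elim_inl]
      fun_prop
    · simp only [u, Sum.elim_inr]
      fun_prop
  have hG : Continuous G := by
    refine Continuous.matrix_det (continuous_matrix fun i j => ?_)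
    simp only [Matrix.gram_apply]
    exact (hu i).inner (hu j)
  have hnn : ∀ p, 0 ≤ G p := fun p => (Matrix.posSemidef_gram (𝕜 := ℝ) (u p)).det_nonneg
  have hG0 : 0 < G (y, 0) := by
    have e : u (y, 0) = Sum.elim (fun i : Fin m => fderiv ℝ J y (EuclideanSpace.single i (1 : ℝ)))
        (fun _ : Unit => (2 : ℝ) • J y) := by simp [u]
    simp only [G]
    rw [e, gram_orth _ _ (fun i => by rw [inner_smul_right, orth_deriv J hJ hJnorm, mul_zero])]
    rw [norm_smul, hJnorm]
    rw [absJac_eq] at h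
    have : 0 < Matrix.det (Matrix.gram ℝ
      fun i => fderiv ℝ J y (EuclideanSpace.single i (1 : ℝ))) := by
      by_contra h0
      exact h (Real.sqrt_eq_zero_of_nonpos (not_lt.1 h0))
    exact mul_pos this (by norm_num)
  have hev : ∀ᶠ p in 𝓝 (y, (0 : ℝ)), G (y, 0) / 2 < G p :=
    hG.continuousAt.eventually (lt_mem_nhds (by linarith))
  obtain ⟨r, hr, hball⟩ := Metric.eventually_nhds_iff.1 hev
  refine ⟨r, hr, max 1 r⁻¹, Real.sqrt (G (y, 0) / 2), by positivity, fun z hz σ hσ => ?_⟩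
  have h1 : 1 < σ := lt_of_le_of_lt (le_max_left _ _) hσ
  have h2 : r⁻¹ < σ := lt_of_le_of_lt (le_max_right _ _) hσ
  have hσ0 : 0 < σ := by linarith
  have h3 : G (y, 0) / 2 < G (z, σ⁻¹) := by
    refine hball ?_
    rw [Prod.dist_eq]
    refine max_lt hz ?_
    simp only [dist_zero_right, norm_inv, Real.norm_of_nonneg hσ0.le]
    exact inv_lt_of_inv_lt₀ hr h2
  refine Real.sqrt_le_sqrt ?_
  have e : (Sum.elim
        (fun i : Fin m => fderiv ℝ f z (EuclideanSpace.single i (1 : ℝ)) +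
            σ • fderiv ℝ J z (EuclideanSpace.single i (1 : ℝ)))
        (fun _ : Unit => (2 : ℝ) • J z)) =
      fun k => (Sum.elim (fun _ : Fin m => σ) (fun _ : Unit => (1 : ℝ)) k) • u (z, σ⁻¹) k := by
    ext1 k
    rcases k with i | i
    · simp only [Sum.elim_inl, u]
      rw [smul_add, smul_smul, mul_inv_cancel₀ hσ0.ne', one_smul, add_comm]
    · simp [u]
  rw [e, gram_scale]
  have hp : (1 : ℝ) ≤ (∏ i, Sum.elim (fun _ : Fin m => σ) (fun _ : Unit => (1 : ℝ)) i) ^ 2 := by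
    rw [Fintype.prod_sum_type]
    simp only [Sum.elim_inl, Sum.elim_inr, Finset.prod_const, one_pow, mul_one]
    exact one_le_pow₀ (one_le_pow₀ h1.le)
  have := hnn (z, σ⁻¹)
  change _ ≤ _ * G (z, σ⁻¹)
  nlinarith

theorem phi_far (f J : EuclideanSpace ℝ (Fin m) → EuclideanSpace ℝ (Fin n))
    (hf : ContDiff ℝ 1 f) (hJ : ContDiff ℝ 1 J) (T : ℝ)
    (Φ : EuclideanSpace ℝ (Fin m) × ℝ → EuclideanSpace ℝ (Fin n))
    (w : EuclideanSpace ℝ (Fin m) × ℝ)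
    (hΦ : ∀ᶠ p in 𝓝 w, Φ p = f p.1 + (2 * (p.2 - T)) • J p.1) :
    ContDiffAt ℝ 1 Φ w ∧ absJacP Φ w = Real.sqrt (Matrix.det (Matrix.gram ℝ (Sum.elim
        (fun i : Fin m => fderiv ℝ f w.1 (EuclideanSpace.single i (1 : ℝ)) +
            (2 * (w.2 - T)) • fderiv ℝ J w.1 (EuclideanSpace.single i (1 : ℝ)))
        (fun _ : Unit => (2 : ℝ) • J w.1)))) := by
  have hc : ContDiff ℝ 1 fun p : EuclideanSpace ℝ (Fin m) × ℝ => f p.1 + (2 * (p.2 - T)) • J p.1 := by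
    fun_prop
  refine ⟨hc.contDiffAt.congr_of_eventuallyEq hΦ, ?_⟩
  have d1 : HasFDerivAt (fun p : EuclideanSpace ℝ (Fin m) × ℝ => f p.1)
      ((fderiv ℝ f w.1).comp (ContinuousLinearMap.fst ℝ _ _)) w :=
    (hf.differentiable (by simp) w.1).hasFDerivAt.comp w hasFDerivAt_fst
  have d2 : HasFDerivAt (fun p : EuclideanSpace ℝ (Fin m) × ℝ => J p.1)
      ((fderiv ℝ J w.1).comp (ContinuousLinearMap.fst ℝ _ _)) w :=
    (hJ.differentiable (by simp) w.1).hasFDerivAt.comp w hasFDerivAt_fst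
  have d3 : HasFDerivAt (fun p : EuclideanSpace ℝ (Fin m) × ℝ => 2 * (p.2 - T))
      ((2 : ℝ) • ContinuousLinearMap.snd ℝ (EuclideanSpace ℝ (Fin m)) ℝ) w :=
    (hasFDerivAt_snd.sub_const T).const_mul 2
  have d := (d1.add (d3.smul d2)).congr_of_eventuallyEq hΦ
  rw [absJacP_eq, d.fderiv]
  congr 4
  · ext1 i
    simp
  · ext1 i
    simp
end

/-- **(Lemma `generalized`, part 1.)** Under Assumption 1, let `y_1, …, y_v` be interior
points of `I` with `J(y_j) = ω₀` (possibly nonregular) and `|DJ(y_j)/Dy| ≠ 0`. Then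
there are neighborhoods `M_j ⊆ I` of `y_j`, `R > 0` and `c > 0` such that (i) `J` is a
diffeomorphism of `M_j` onto `J(M_j)`, and (ii) for `y ∈ M_j` and `s` with
`|x_s(y)| > R`, the map `(y,s) ↦ x_s(y)` is a local diffeomorphism at `(y,s)` whose
absolute Jacobian determinant `|D(x)/D(y,s)|` is at least `c`. -/
theorem stmt4 (n : ℕ) (hn : 2 ≤ n)
    -- the potential: smooth, compactly supported
    (q : EuclideanSpace ℝ (Fin n) → ℝ)
    (hq_smooth : ContDiff ℝ (⊤ : ℕ∞) q) (hq_cpt : HasCompactSupport q)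
    -- incoming direction: a unit vector
    (θ₀ : EuclideanSpace ℝ (Fin n)) (hθ₀ : ‖θ₀‖ = 1)
    -- the offset `a` of the initial hyperplane `xⁿ = −a`:
    -- `supp q ⊆ {x : xⁿ > −a} ∩ {|x| < a}`
    (a : ℝ) (ha : 0 < a)
    (hsupp : tsupport q ⊆ {x | -a < ⟪x, θ₀⟫} ∩ Metric.ball 0 a)
    -- identification of `ℝ^{n-1}` with the hyperplane `θ₀^⊥`
    (ι : EuclideanSpace ℝ (Fin (n - 1)) →ₗᵢ[ℝ] EuclideanSpace ℝ (Fin n))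
    (hι : ∀ y, ⟪ι y, θ₀⟫ = 0)
    (hι_range : ∀ x : EuclideanSpace ℝ (Fin n), ⟪x, θ₀⟫ = 0 → x ∈ Set.range ι)
    -- the Hamiltonian flow `dx/ds = 2p`, `dp/ds = ∇q(x)`, `x₀ = (y,−a)`, `p₀ = θ₀`
    (X P : EuclideanSpace ℝ (Fin (n - 1)) → ℝ → EuclideanSpace ℝ (Fin n))
    (hX0 : ∀ y, X y 0 = ι y - a • θ₀) (hP0 : ∀ y, P y 0 = θ₀)
    (hX' : ∀ y t, HasDerivAt (X y) ((2 : ℝ) • P y t) t)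
    (hP' : ∀ y t, HasDerivAt (P y) (gradient q (X y t)) t)
    -- Assumption 1: non-trapping
    (hA1 : ∀ c : ℝ, ∃ T : ℝ, ∀ y, ∀ s > T, c < ‖X y s‖)
    -- `I`: the projection of `supp q` on the hyperplane `xⁿ = −a`
    (Iset : Set (EuclideanSpace ℝ (Fin (n - 1))))
    (hIset : Iset = {y | ∃ x ∈ tsupport q,
      (ι y : EuclideanSpace ℝ (Fin n)) = x - ⟪x, θ₀⟫ • θ₀})
    -- the classical scattering direction map `J(y) = lim_{t→∞} p_t(y)`, a smooth
    -- sphere-valued map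
    (J : EuclideanSpace ℝ (Fin (n - 1)) → EuclideanSpace ℝ (Fin n))
    (hJ : ∀ y, Tendsto (fun t => P y t) atTop (𝓝 (J y)))
    (hJnorm : ∀ y, ‖J y‖ = 1) (hJsmooth : ContDiff ℝ (⊤ : ℕ∞) J)
    -- the points `y_1, …, y_v` in the interior of `I`, mapped by `J` to a common
    -- (possibly nonregular) direction `ω₀`, with nonvanishing Jacobian
    (ω₀ : EuclideanSpace ℝ (Fin n)) (hω₀ : ω₀ ∈ Metric.sphere (0 : EuclideanSpace ℝ (Fin n)) 1)
    (v : ℕ) (y : Fin v → EuclideanSpace ℝ (Fin (n - 1)))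
    (hy_int : ∀ j, y j ∈ interior Iset)
    (hy_ω₀ : ∀ j, J (y j) = ω₀)
    (hy_reg : ∀ j, absJac J (y j) ≠ 0) :
    ∃ (M : Fin v → Set (EuclideanSpace ℝ (Fin (n - 1)))) (R c : ℝ), 0 < R ∧ 0 < c ∧
      (∀ j : Fin v,
        -- (i) `M j` is a neighborhood of `y j` in `I` on which `J` is a diffeomorphism
        -- onto its image
        IsOpen (M j) ∧ y j ∈ M j ∧ M j ⊆ Iset ∧ Set.InjOn J (M j) ∧
        (∃ Jinv : EuclideanSpace ℝ (Fin n) → EuclideanSpace ℝ (Fin (n - 1)),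
          (∀ z ∈ M j, Jinv (J z) = z) ∧ ContDiffOn ℝ (⊤ : ℕ∞) Jinv (J '' M j))) ∧
      (∀ j : Fin v, ∀ z ∈ M j, ∀ s : ℝ, R < ‖X z s‖ →
        -- (ii) `(y,s) ↦ x_s(y)` is a local diffeomorphism at `(z,s)` ...
        (∃ U : Set (EuclideanSpace ℝ (Fin (n - 1)) × ℝ), IsOpen U ∧ (z, s) ∈ U ∧
          Set.InjOn (fun w : EuclideanSpace ℝ (Fin (n - 1)) × ℝ => X w.1 w.2) U ∧
          IsOpen ((fun w : EuclideanSpace ℝ (Fin (n - 1)) × ℝ => X w.1 w.2) '' U)) ∧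
        -- ... with absolute Jacobian determinant bounded below by `c`
        c ≤ absJacP (fun w : EuclideanSpace ℝ (Fin (n - 1)) × ℝ => X w.1 w.2) (z, s)) := by
  have hm : n - 1 + 1 = n := by omega
  obtain ⟨hneg, hlip, T, hT, hfT, hfar⟩ := flow_facts q hq_smooth hq_cpt θ₀ hθ₀ a hsupp ι hι X P
    hX0 hP0 hX' hP' hA1 J hJ
  have hJ1 : ContDiff ℝ 1 J := hJsmooth.of_le (by exact_mod_cast le_top)
  set Φ : EuclideanSpace ℝ (Fin (n - 1)) × ℝ → EuclideanSpace ℝ (Fin n) :=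
    fun w => X w.1 w.2 with hΦ
  have key : ∀ j, ∃ M : Set (EuclideanSpace ℝ (Fin (n - 1))), ∃ R c : ℝ, 0 < c ∧
      (IsOpen M ∧ y j ∈ M ∧ M ⊆ Iset ∧ Set.InjOn J M ∧
        (∃ Jinv : EuclideanSpace ℝ (Fin n) → EuclideanSpace ℝ (Fin (n - 1)),
          (∀ z ∈ M, Jinv (J z) = z) ∧ ContDiffOn ℝ (⊤ : ℕ∞) Jinv (J '' M))) ∧
      ∀ z ∈ M, ∀ s : ℝ, R < ‖X z s‖ → ContDiffAt ℝ 1 Φ (z, s) ∧ c ≤ absJacP Φ (z, s) := by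
    intro j
    obtain ⟨N, hN, hyN, Jinv, hJi, hJc⟩ := local_inv J hJsmooth (y j) (hy_reg j)
    obtain ⟨r, hr, S, c, hc, hb⟩ := far_jac _ J hfT hJsmooth hJnorm (y j) (hy_reg j)
    let S' := T + max 0 S
    obtain ⟨C, hC⟩ := hlip S'
    obtain ⟨B, hB⟩ := (isCompact_Icc (a := (0 : ℝ)) (b := S')).exists_bound_of_continuousOn
      (f := X (y j)) (fun t _ => (hX' (y j) t).continuousAt.continuousWithinAt)
    refine ⟨N ∩ interior Iset ∩ ball (y j) r, B + |C| * r, min c 2, by positivity,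
      ⟨(hN.inter isOpen_interior).inter isOpen_ball, ⟨⟨hyN, hy_int j⟩, mem_ball_self hr⟩,
        fun z hz => interior_subset hz.1.2, ?_, Jinv, fun z hz => hJi z hz.1.1,
        hJc.mono (Set.image_mono fun z hz => hz.1.1)⟩, ?_⟩
    · intro z hz z' hz' e
      rw [← hJi z hz.1.1, ← hJi z' hz'.1.1, e]
    · intro z hz s hs
      have hout : s < 0 ∨ S' < s := by
        by_contra hcon
        push Not at hcon
        have hsI : s ∈ Set.Icc 0 S' := hcon
        have h1 := hC z (y j) s hsI
        have h2 := hB s hsI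
        have h3 : ‖X z s‖ ≤ ‖X z s - X (y j) s‖ + ‖X (y j) s‖ := by
          simpa using norm_add_le (X z s - X (y j) s) (X (y j) s)
        have h4 : ‖z - y j‖ ≤ r := by
          rw [← dist_eq_norm]; exact (mem_ball.1 hz.2).le
        have h5 : C * ‖z - y j‖ ≤ |C| * r :=
          mul_le_mul (le_abs_self C) h4 (norm_nonneg _) (abs_nonneg _)
        linarith
      rcases hout with hs0 | hs1
      · have hev : ∀ᶠ p in 𝓝 (z, s), Φ p = ι p.1 + (2 * (p.2 - a / 2)) • θ₀ := by
          have : ∀ᶠ p : EuclideanSpace ℝ (Fin (n - 1)) × ℝ in 𝓝 (z, s), p.2 < 0 :=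
            continuous_snd.continuousAt.eventually (gt_mem_nhds hs0)
          filter_upwards [this] with p hp
          rw [hΦ]
          simp only
          rw [hneg p.1 p.2 hp.le]
          congr 2
          ring
        obtain ⟨p1, p2⟩ := phi_far (fun y => ι y) (fun _ => θ₀) ι.contDiff contDiff_const (a / 2) Φ
          (z, s) hev
        refine ⟨p1, (min_le_right _ _).trans ?_⟩
        rw [p2]
        have hfd : fderiv ℝ (fun y => ι y) z = ι.toContinuousLinearMap :=
          ι.toContinuousLinearMap.fderiv
        simp only [hfd, fderiv_const_apply, _root_.zero_apply, smul_zero, add_zero]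
        rw [gram_orth _ _ (fun i => by
          rw [inner_smul_right, LinearIsometry.coe_toContinuousLinearMap, hι, mul_zero])]
        have : Matrix.gram ℝ (fun i : Fin (n - 1) =>
            ι.toContinuousLinearMap (EuclideanSpace.single i (1 : ℝ))) = 1 := by
          rw [Matrix.gram_eq_one_iff_orthonormal]
          have h0 := (EuclideanSpace.basisFun (Fin (n - 1)) ℝ).orthonormal
          have h1 := h0.comp_linearIsometry ι
          have h2 : (ι ∘ (EuclideanSpace.basisFun (Fin (n - 1)) ℝ)) =
              fun i : Fin (n - 1) => ι.toContinuousLinearMap (EuclideanSpace.single i (1 : ℝ)) := by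
            ext1 i
            simp
          rw [h2] at h1
          exact h1
        rw [this, Matrix.det_one, norm_smul, hθ₀]
        refine Real.le_sqrt_of_sq_le ?_
        norm_num
      · have hTs : T < s := lt_of_le_of_lt (le_add_of_nonneg_right (le_max_left _ _)) hs1
        have hev : ∀ᶠ p in 𝓝 (z, s), Φ p = X p.1 T + (2 * (p.2 - T)) • J p.1 := by
          have : ∀ᶠ p : EuclideanSpace ℝ (Fin (n - 1)) × ℝ in 𝓝 (z, s), T < p.2 :=
            continuous_snd.continuousAt.eventually (lt_mem_nhds hTs)
          filter_upwards [this] with p hp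
          exact hfar p.1 p.2 hp.le
        obtain ⟨p1, p2⟩ := phi_far _ J hfT hJ1 T Φ (z, s) hev
        refine ⟨p1, (min_le_left _ _).trans ?_⟩
        rw [p2]
        refine hb z hz.2 _ ?_
        have := le_max_right 0 S
        simp only [S'] at hs1
        have : 0 ≤ max 0 S := le_max_left _ _
        simp only
        linarith
  choose M R c hc h1 h2 using key
  obtain ⟨R', hR'⟩ := ((eventually_gt_atTop (0 : ℝ)).and
    (eventually_all.2 fun j => eventually_ge_atTop (R j))).exists
  obtain ⟨c', hc'⟩ := ((eventually_mem_nhdsWithin (a := (0 : ℝ)) (s := Set.Ioi 0)).and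
    (eventually_all.2 fun j => nhdsWithin_le_nhds (Iic_mem_nhds (hc j)))).exists
  refine ⟨M, R', c', hR'.1, hc'.1, h1, fun j z hz s hs => ?_⟩
  obtain ⟨k1, k2⟩ := h2 j z hz s ((hR'.2 j).trans_lt hs)
  refine ⟨local_diffeo hm Φ (z, s) k1 ((hc j).trans_le k2).ne', le_trans (hc'.2 j) k2⟩
end

section
/- Assume Assumption 1 and that supp q ⊂ {|x| < a}. Then there exists T > 0 such that for every y ∈ ℝ^{n-1} and every t ≥ T one has p_t(y) = p_T(y); consequently, for every y the limit J(y) := lim_{t→∞} p_t(y) exists, satisfies |J(y)| = 1, and the map y ↦ J(y) is smooth (C^∞) on ℝ^{n-1}. -/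
open MeasureTheory Filter Topology Metric
open scoped RealInnerProductSpace

section Nemytskii

variable {K : Type} [TopologicalSpace K] [CompactSpace K]
variable {E : Type} [NormedAddCommGroup E] [NormedSpace ℝ E]
variable {G : Type} [NormedAddCommGroup G] [NormedSpace ℝ G]

/-- Pointwise application of a continuous family of operators, as a bilinear map. -/
noncomputable def pointApply (K E G : Type) [TopologicalSpace K] [CompactSpace K]
    [NormedAddCommGroup E] [NormedSpace ℝ E] [NormedAddCommGroup G] [NormedSpace ℝ G] :
    C(K, E →L[ℝ] G) →L[ℝ] C(K, E) →L[ℝ] C(K, G) :=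
  LinearMap.mkContinuous₂
    (LinearMap.mk₂ ℝ
      (fun (A : C(K, E →L[ℝ] G)) (h : C(K, E)) =>
        (⟨fun t => A t (h t), A.continuous.clm_apply h.continuous⟩ : C(K, G)))
      (fun A B h => by ext t; simp)
      (fun c A h => by ext t; simp)
      (fun A h k => by ext t; simp)
      (fun c A h => by ext t; simp)) 1
    (fun A h => by
      rw [ContinuousMap.norm_le _ (by positivity)]
      intro t
      simp only [LinearMap.mk₂_apply, ContinuousMap.coe_mk, one_mul]
      exact ((A t).le_opNorm _).trans
        (mul_le_mul (A.norm_coe_le_norm t) (h.norm_coe_le_norm t) (norm_nonneg _) (by positivity)))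

@[simp] lemma pointApply_apply (A : C(K, E →L[ℝ] G)) (h : C(K, E)) (t : K) :
    pointApply K E G A h t = A t (h t) := rfl

/-- The derivative of the superposition operator. -/
lemma hasFDerivAt_superposition (F : C(E, G)) (F' : C(E, E →L[ℝ] G))
    (hF : ∀ x, HasFDerivAt F (F' x) x) (γ : C(K, E)) :
    HasFDerivAt (fun δ : C(K, E) => F.comp δ) (pointApply K E G (F'.comp γ)) γ := by
  rw [hasFDerivAt_iff_isLittleO, Asymptotics.isLittleO_iff]
  intro ε hε
  have hc : ContinuousAt (fun δ : C(K, E) => F'.comp δ) γ :=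
    (ContinuousMap.continuous_postcomp F').continuousAt
  obtain ⟨r, hr, hb⟩ := (Metric.continuousAt_iff (f := fun δ : C(K, E) => F'.comp δ) (a := γ)).1 hc ε hε
  filter_upwards [Metric.ball_mem_nhds γ hr] with δ hδ
  rw [ContinuousMap.norm_le _ (by positivity)]
  intro t
  have key := (convex_segment (𝕜 := ℝ) (γ t) (δ t)).norm_image_sub_le_of_norm_hasFDerivWithin_le'
    (f := F) (f' := F') (φ := F' (γ t)) (C := ε)
    (fun x _ => (hF x).hasFDerivWithinAt) ?_ (left_mem_segment ℝ _ _) (right_mem_segment ℝ _ _)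
  · refine key.trans ?_
    gcongr
    simpa using (δ - γ).norm_coe_le_norm t
  · rintro x hx
    rw [segment_eq_image'] at hx
    obtain ⟨s, hs, rfl⟩ := hx
    have h1 : dist (γ + s • (δ - γ)) γ < r := by
      rw [dist_eq_norm, add_sub_cancel_left, norm_smul, Real.norm_of_nonneg hs.1]
      have := mem_ball_iff_norm.1 hδ
      nlinarith [hs.2, norm_nonneg (δ - γ)]
    have h2 := hb h1
    have h3 := (ContinuousMap.dist_apply_le_dist (f := F'.comp (γ + s • (δ - γ)))
      (g := F'.comp γ) t).trans h2.le
    rw [dist_eq_norm] at h3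
    exact h3

lemma contDiff_superposition_nat (k : ℕ) : ∀ (G : Type) [NormedAddCommGroup G] [NormedSpace ℝ G]
    (F : C(E, G)), ContDiff ℝ k F → ContDiff ℝ k (fun δ : C(K, E) => F.comp δ) := by
  induction k with
  | zero =>
    intro G _ _ F _
    exact contDiff_zero.2 (ContinuousMap.continuous_postcomp F)
  | succ k ih =>
    intro G _ _ F hF
    obtain ⟨F', hF', hd⟩ := contDiff_succ_iff_hasFDerivAt.1 hF
    refine contDiff_succ_iff_hasFDerivAt.2
      ⟨fun γ => pointApply K E G ((⟨F', hF'.continuous⟩ : C(E, E →L[ℝ] G)).comp γ), ?_,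
        fun γ => hasFDerivAt_superposition F ⟨F', hF'.continuous⟩ hd γ⟩
    exact (pointApply K E G).contDiff.comp (ih _ ⟨F', hF'.continuous⟩ hF')

lemma contDiff_superposition (F : C(E, G)) (hF : ContDiff ℝ (⊤ : ℕ∞) F) :
    ContDiff ℝ (⊤ : ℕ∞) (fun δ : C(K, E) => F.comp δ) :=
  contDiff_infty.2 fun k => contDiff_superposition_nat k G F (contDiff_infty.1 hF k)

end Nemytskii

section Volterra

variable {E : Type} [NormedAddCommGroup E] [NormedSpace ℝ E]

/-- The integration operator on `C([0, τ], E)`. -/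
noncomputable def volt (E : Type) [NormedAddCommGroup E] [NormedSpace ℝ E] (τ : ℝ) (hτ : 0 ≤ τ) :
    C(Set.Icc (0 : ℝ) τ, E) →L[ℝ] C(Set.Icc (0 : ℝ) τ, E) :=
  LinearMap.mkContinuous
    { toFun := fun f => ⟨fun t => ∫ s in (0 : ℝ)..t, f (Set.projIcc 0 τ hτ s),
        (intervalIntegral.continuous_primitive
          (fun a b => (f.continuous.comp continuous_projIcc).intervalIntegrable a b) 0).comp
          continuous_subtype_val⟩
      map_add' := fun f g => by
        ext t
        simp only [ContinuousMap.add_apply, ContinuousMap.coe_mk]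
        exact intervalIntegral.integral_add
          ((f.continuous.comp continuous_projIcc).intervalIntegrable _ _)
          ((g.continuous.comp continuous_projIcc).intervalIntegrable _ _)
      map_smul' := fun c f => by
        ext t
        simp only [ContinuousMap.smul_apply, ContinuousMap.coe_mk, RingHom.id_apply]
        exact intervalIntegral.integral_smul _ _ } τ
    (fun f => by
      rw [ContinuousMap.norm_le _ (by positivity)]
      intro t
      have h := intervalIntegral.norm_integral_le_of_norm_le_const (a := (0 : ℝ)) (b := t)
        (f := fun s => f (Set.projIcc 0 τ hτ s)) (C := ‖f‖)
        (fun s _ => f.norm_coe_le_norm _)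
      refine h.trans ?_
      rw [sub_zero, abs_of_nonneg t.2.1, mul_comm]
      exact mul_le_mul_of_nonneg_right t.2.2 (norm_nonneg _))

lemma volt_apply (τ : ℝ) (hτ : 0 ≤ τ) (f : C(Set.Icc (0 : ℝ) τ, E)) (t : Set.Icc (0 : ℝ) τ) :
    volt E τ hτ f t = ∫ s in (0 : ℝ)..t, f (Set.projIcc 0 τ hτ s) := rfl

lemma volt_norm (τ : ℝ) (hτ : 0 ≤ τ) : ‖volt E τ hτ‖ ≤ τ :=
  LinearMap.mkContinuous_norm_le _ hτ _

variable [CompleteSpace E]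

/-- One short time step preserves smooth dependence on a parameter. -/
lemma flow_step {Y : Type} [NormedAddCommGroup Y] [NormedSpace ℝ Y]
    (F : E → E) (hF : ContDiff ℝ (⊤ : ℕ∞) F) (L : NNReal) (hL : LipschitzWith L F)
    (Z : Y → ℝ → E) (hZ : ∀ y t, HasDerivAt (Z y) (F (Z y t)) t)
    (s τ : ℝ) (hτ : 0 ≤ τ) (hτL : τ * L < 1)
    (h0 : ContDiff ℝ (⊤ : ℕ∞) (fun y => Z y s)) :
    ContDiff ℝ (⊤ : ℕ∞) (fun y => Z y (s + τ)) := by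
  have hZc : ∀ y, Continuous (Z y) := fun y =>
    continuous_iff_continuousAt.2 fun t => (hZ y t).continuousAt
  let Fc : C(E, E) := ⟨F, hF.continuous⟩
  let N : C(Set.Icc (0 : ℝ) τ, E) → C(Set.Icc (0 : ℝ) τ, E) := fun γ => volt E τ hτ (Fc.comp γ)
  have hN : ContDiff ℝ (⊤ : ℕ∞) N := (volt E τ hτ).contDiff.comp (contDiff_superposition Fc hF)
  have hNL : ∀ γ δ, ‖N γ - N δ‖ ≤ (τ * L) * ‖γ - δ‖ := by
    intro γ δ
    have h1 : N γ - N δ = volt E τ hτ (Fc.comp γ - Fc.comp δ) := by simp [N]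
    rw [h1]
    refine ((volt E τ hτ).le_opNorm _).trans ?_
    rw [mul_assoc]
    refine mul_le_mul (volt_norm τ hτ) ?_ (norm_nonneg _) hτ
    rw [ContinuousMap.norm_le _ (by positivity)]
    intro t
    have h2 := hL.dist_le_mul (γ t) (δ t)
    rw [dist_eq_norm, dist_eq_norm] at h2
    refine h2.trans ?_
    gcongr
    exact (γ - δ).norm_coe_le_norm t
  have hNlip : LipschitzWith (τ * L).toNNReal N := by
    refine LipschitzWith.of_dist_le_mul fun γ δ => ?_
    rw [dist_eq_norm, dist_eq_norm, Real.coe_toNNReal _ (by positivity)]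
    exact hNL γ δ
  let Ψ : C(Set.Icc (0 : ℝ) τ, E) → C(Set.Icc (0 : ℝ) τ, E) := fun γ => γ - N γ
  have hΨ : ContDiff ℝ (⊤ : ℕ∞) Ψ := contDiff_id.sub hN
  let c : Y → C(Set.Icc (0 : ℝ) τ, E) := fun y =>
    ⟨fun t => Z y (s + t), (hZc y).comp (continuous_const.add continuous_subtype_val)⟩
  let cst : E →L[ℝ] C(Set.Icc (0 : ℝ) τ, E) := ContinuousLinearMap.const ℝ (Set.Icc (0 : ℝ) τ)
  have hΨc : ∀ y, Ψ (c y) = cst (Z y s) := by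
    intro y
    ext t
    have h1 : N (c y) t = ∫ u in (0 : ℝ)..t, F (Z y (s + u)) := by
      change (∫ u in (0 : ℝ)..t, F (Z y (s + (Set.projIcc 0 τ hτ u : ℝ)))) = _
      refine intervalIntegral.integral_congr fun u hu => ?_
      rw [Set.uIcc_of_le t.2.1] at hu
      have : Set.projIcc 0 τ hτ u = ⟨u, hu.1, hu.2.trans t.2.2⟩ := Set.projIcc_of_mem hτ _
      simp only [this]
    have h2 : ∫ u in (0 : ℝ)..t, F (Z y (s + u)) = Z y (s + t) - Z y (s + 0) := by
      refine intervalIntegral.integral_eq_sub_of_hasDerivAt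
        (f := fun u => Z y (s + u)) (fun u _ => (hZ y (s + u)).comp_const_add s u) ?_
      exact (hF.continuous.comp ((hZc y).comp (continuous_const.add continuous_id))).intervalIntegrable _ _
    change Z y (s + t) - N (c y) t = Z y s
    rw [h1, h2, add_zero]
    abel
  have hcont : Continuous c := by
    refine continuous_iff_continuousAt.2 fun y₀ => ?_
    rw [ContinuousAt, tendsto_iff_norm_sub_tendsto_zero]
    have hb : ∀ y, ‖c y - c y₀‖ ≤ (1 - τ * L)⁻¹ * ‖cst (Z y s) - cst (Z y₀ s)‖ := by
      intro y
      have hpos : 0 < 1 - τ * L := by linarith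
      rw [inv_mul_eq_div, le_div_iff₀ hpos, ← hΨc, ← hΨc]
      have e : c y - c y₀ = (Ψ (c y) - Ψ (c y₀)) + (N (c y) - N (c y₀)) := by
        simp only [Ψ]; abel
      have h3 := norm_add_le (Ψ (c y) - Ψ (c y₀)) (N (c y) - N (c y₀))
      rw [← e] at h3
      nlinarith [hNL (c y) (c y₀)]
    refine squeeze_zero (fun _ => norm_nonneg _) hb ?_
    have h4 : Continuous fun y => (1 - τ * L)⁻¹ * ‖cst (Z y s) - cst (Z y₀ s)‖ :=
      continuous_const.mul (((cst.continuous.comp h0.continuous).sub continuous_const).norm)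
    simpa using h4.tendsto y₀
  have hc : ContDiff ℝ (⊤ : ℕ∞) c := by
    refine contDiff_iff_contDiffAt.2 fun y₀ => ?_
    have hlt : ‖fderiv ℝ N (c y₀)‖ < 1 := by
      refine (norm_fderiv_le_of_lipschitz ℝ hNlip).trans_lt ?_
      rw [Real.coe_toNNReal _ (by positivity)]
      exact hτL
    let e := ContinuousLinearEquiv.unitsEquiv ℝ _ (Units.oneSub (fderiv ℝ N (c y₀)) hlt)
    have he : HasFDerivAt Ψ (e : C(Set.Icc (0 : ℝ) τ, E) →L[ℝ] C(Set.Icc (0 : ℝ) τ, E)) (c y₀) := by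
      have h5 := (hasFDerivAt_id (𝕜 := ℝ) (c y₀)).sub
        ((hN.differentiable (by simp)) (c y₀)).hasFDerivAt
      exact h5
    have hA := hΨ.contDiffAt (x := c y₀)
    have hinv := hA.to_localInverse he (by simp)
    rw [hΨc] at hinv
    have hcomp : ContDiffAt ℝ (⊤ : ℕ∞)
        (fun y => hA.localInverse he (by simp) (cst (Z y s))) y₀ :=
      ContDiffAt.comp (f := fun y => cst (Z y s)) y₀ hinv (cst.contDiff.comp h0).contDiffAt
    refine hcomp.congr_of_eventuallyEq ?_
    have hev := (hA.hasStrictFDerivAt' he (by simp)).eventually_left_inverse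
    filter_upwards [hcont.continuousAt.eventually hev] with y hy
    rw [← hΨc]
    exact hy.symm
  exact (ContinuousMap.evalCLM ℝ (⟨τ, hτ, le_rfl⟩ : Set.Icc (0 : ℝ) τ)).contDiff.comp hc

lemma flow_smooth {Y : Type} [NormedAddCommGroup Y] [NormedSpace ℝ Y]
    (F : E → E) (hF : ContDiff ℝ (⊤ : ℕ∞) F) (L : NNReal) (hL : LipschitzWith L F)
    (Z : Y → ℝ → E) (hZ : ∀ y t, HasDerivAt (Z y) (F (Z y t)) t)
    (T : ℝ) (hT : 0 ≤ T)
    (h0 : ContDiff ℝ (⊤ : ℕ∞) (fun y => Z y 0)) :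
    ContDiff ℝ (⊤ : ℕ∞) (fun y => Z y T) := by
  obtain ⟨m, hm⟩ := exists_nat_gt (T * L)
  have hm0 : (0 : ℝ) < m := lt_of_le_of_lt (by positivity) hm
  have h : ∀ k : ℕ, ContDiff ℝ (⊤ : ℕ∞) (fun y => Z y (k * (T / m))) := by
    intro k
    induction k with
    | zero => simpa using h0
    | succ k ih =>
      have := flow_step F hF L hL Z hZ _ (T / m) (by positivity)
        (by rw [div_mul_eq_mul_div, div_lt_one hm0]; exact hm) ih
      convert this using 3
      push_cast; ring
  have := h m
  rwa [mul_div_cancel₀ _ hm0.ne'] at this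

end Volterra

/-- Under Assumption 1 (and `supp q ⊆ {|x| < a}`), there is `T > 0` such that the
momentum `p_t(y)` is constant for `t ≥ T`, for every `y`; consequently
`J(y) = lim_{t→∞} p_t(y)` exists for every `y`, is a unit vector, and `y ↦ J(y)` is
`C^∞` on `ℝ^{n-1}`. -/
theorem stmt8 (n : ℕ) (hn : 2 ≤ n)
    -- the potential: smooth, compactly supported
    (q : EuclideanSpace ℝ (Fin n) → ℝ)
    (hq_smooth : ContDiff ℝ (⊤ : ℕ∞) q) (hq_cpt : HasCompactSupport q)
    -- incoming direction: a unit vector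
    (θ₀ : EuclideanSpace ℝ (Fin n)) (hθ₀ : ‖θ₀‖ = 1)
    -- the offset `a` of the initial hyperplane `xⁿ = −a`:
    -- `supp q ⊆ {x : xⁿ > −a} ∩ {|x| < a}`
    (a : ℝ) (ha : 0 < a)
    (hsupp : tsupport q ⊆ {x | -a < ⟪x, θ₀⟫} ∩ Metric.ball 0 a)
    -- identification of `ℝ^{n-1}` with the hyperplane `θ₀^⊥`
    (ι : EuclideanSpace ℝ (Fin (n - 1)) →ₗᵢ[ℝ] EuclideanSpace ℝ (Fin n))
    (hι : ∀ y, ⟪ι y, θ₀⟫ = 0)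
    (hι_range : ∀ x : EuclideanSpace ℝ (Fin n), ⟪x, θ₀⟫ = 0 → x ∈ Set.range ι)
    -- the Hamiltonian flow `dx/ds = 2p`, `dp/ds = ∇q(x)`, `x₀ = (y,−a)`, `p₀ = θ₀`
    (X P : EuclideanSpace ℝ (Fin (n - 1)) → ℝ → EuclideanSpace ℝ (Fin n))
    (hX0 : ∀ y, X y 0 = ι y - a • θ₀) (hP0 : ∀ y, P y 0 = θ₀)
    (hX' : ∀ y t, HasDerivAt (X y) ((2 : ℝ) • P y t) t)
    (hP' : ∀ y t, HasDerivAt (P y) (gradient q (X y t)) t)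
    -- Assumption 1: non-trapping
    (hA1 : ∀ c : ℝ, ∃ T : ℝ, ∀ y, ∀ s > T, c < ‖X y s‖)
    :
    ∃ T : ℝ, 0 < T ∧ (∀ y, ∀ t ≥ T, P y t = P y T) ∧
      ∃ J : EuclideanSpace ℝ (Fin (n - 1)) → EuclideanSpace ℝ (Fin n),
        (∀ y, Tendsto (fun t => P y t) atTop (𝓝 (J y))) ∧
        (∀ y, ‖J y‖ = 1) ∧
        ContDiff ℝ (⊤ : ℕ∞) J := by
  have hg : ContDiff ℝ (⊤ : ℕ∞) (gradient q) := by
    have h1 : ContDiff ℝ (⊤ : ℕ∞) (fderiv ℝ q) := hq_smooth.fderiv_right (by simp)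
    exact (InnerProductSpace.toDual ℝ (EuclideanSpace ℝ (Fin n))).symm.contDiff.comp h1
  have hgsupp : ∀ x, x ∉ tsupport q → gradient q x = 0 := by
    intro x hx
    have h1 : fderiv ℝ q x = 0 := by
      by_contra h
      exact hx (support_fderiv_subset ℝ h)
    simp [gradient, h1]
  have hgcpt : HasCompactSupport (gradient q) := by
    refine HasCompactSupport.intro hq_cpt hgsupp
  obtain ⟨L, hL⟩ := ContDiff.lipschitzWith_of_hasCompactSupport hgcpt hg (by simp)
  -- the flow as a first-order system
  let F : EuclideanSpace ℝ (Fin n) × EuclideanSpace ℝ (Fin n) →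
      EuclideanSpace ℝ (Fin n) × EuclideanSpace ℝ (Fin n) :=
    fun z => ((2 : ℝ) • z.2, gradient q z.1)
  have hF : ContDiff ℝ (⊤ : ℕ∞) F :=
    (contDiff_snd.const_smul (2 : ℝ)).prodMk (hg.comp contDiff_fst)
  have hFL : LipschitzWith (max (‖(2 : ℝ)‖₊ * 1) (L * 1)) F :=
    ((lipschitzWith_smul (2 : ℝ)).comp LipschitzWith.prod_snd).prodMk
      (hL.comp LipschitzWith.prod_fst)
  obtain ⟨T₀, hT₀⟩ := hA1 a
  let T : ℝ := max T₀ 0 + 1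
  have hTpos : 0 < T := by positivity
  have hTT : T₀ < T := by
    have := le_max_left T₀ 0
    simp only [T]; linarith
  have hout : ∀ y, ∀ t ≥ T, X y t ∉ tsupport q := by
    intro y t ht hmem
    have h1 := (hsupp hmem).2
    rw [mem_ball_zero_iff] at h1
    exact absurd (hT₀ y t (lt_of_lt_of_le hTT ht)) (not_lt.2 h1.le)
  have hconst : ∀ y, ∀ t ≥ T, P y t = P y T := by
    intro y t ht
    refine constant_of_has_deriv_right_zero (f := P y) (a := T) (b := t)
      (fun s _ => (hP' y s).continuousAt.continuousWithinAt) (fun s hs => ?_) t ⟨ht, le_rfl⟩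
    have := (hP' y s).hasDerivWithinAt (s := Set.Ici s)
    rwa [hgsupp _ (hout y s hs.1)] at this
  have henergy : ∀ y, ‖P y T‖ = 1 := by
    intro y
    have hder : ∀ t, HasDerivAt (fun t => ⟪P y t, P y t⟫ - q (X y t)) 0 t := by
      intro t
      have h1 := (hP' y t).inner ℝ (hP' y t)
      have h2 : HasDerivAt (fun t => q (X y t)) (fderiv ℝ q (X y t) ((2 : ℝ) • P y t)) t :=
        ((hq_smooth.differentiable (by simp)) (X y t)).hasFDerivAt.comp_hasDerivAt t (hX' y t)
      have h3 := h1.sub h2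
      have h4 : fderiv ℝ q (X y t) ((2 : ℝ) • P y t) = 2 * ⟪gradient q (X y t), P y t⟫ := by
        rw [map_smul, smul_eq_mul, gradient, InnerProductSpace.toDual_symm_apply]
      have h5 : ⟪P y t, gradient q (X y t)⟫ + ⟪gradient q (X y t), P y t⟫
          - fderiv ℝ q (X y t) ((2 : ℝ) • P y t) = 0 := by
        rw [h4, real_inner_comm (gradient q (X y t)) (P y t)]
        ring
      rw [h5] at h3
      exact h3
    have hq0 : q (X y 0) = 0 := by
      refine image_eq_zero_of_notMem_tsupport fun hmem => ?_
      have h1 := (hsupp hmem).1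
      rw [hX0] at h1
      simp only [Set.mem_ofPred_eq, inner_sub_left, hι, real_inner_smul_left,
        real_inner_self_eq_norm_sq, hθ₀] at h1
      linarith
    have hqT : q (X y T) = 0 := image_eq_zero_of_notMem_tsupport (hout y T le_rfl)
    have heq := is_const_of_deriv_eq_zero (fun t => (hder t).differentiableAt)
      (fun t => (hder t).deriv) T 0
    simp only [hq0, hqT, hP0, real_inner_self_eq_norm_sq, hθ₀] at heq
    nlinarith [norm_nonneg (P y T)]
  refine ⟨T, hTpos, hconst, fun y => P y T, fun y => ?_, henergy, ?_⟩
  · refine tendsto_const_nhds.congr' ?_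
    filter_upwards [eventually_ge_atTop T] with t ht
    exact (hconst y t ht).symm
  · have hsm := flow_smooth F hF _ hFL (fun y t => (X y t, P y t))
      (fun y t => (hX' y t).prodMk (hP' y t)) T hTpos.le (by
        simp only [hX0, hP0]
        exact (ι.contDiff.sub contDiff_const).prodMk contDiff_const)
    exact contDiff_snd.comp hsm
end

section
/- (Vanishing of oscillatory integrals with almost-nowhere-stationary phase.) Let U ⊆ ℝ^d be open, F : U → ℝ continuously differentiable, and g : U → ℂ continuous with compact support contained in U. If the set {x ∈ supp g : ∇F(x) = 0} has Lebesgue measure zero, then ∫_U g(x) e^{i k F(x)} dx → 0 as k → ∞. -/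
open MeasureTheory Filter Topology

lemma aux_local {d : ℕ} {F : EuclideanSpace ℝ (Fin d) → ℝ} {x₀ : EuclideanSpace ℝ (Fin d)}
    {L : EuclideanSpace ℝ (Fin d) →L[ℝ] ℝ}
    (hF : HasStrictFDerivAt F L x₀) (hL : L ≠ 0) {N : Set ℝ} (hNm : MeasurableSet N)
    (hN : volume N = 0) :
    ∃ s ∈ 𝓝 x₀, volume (s ∩ F ⁻¹' N) = 0 := by
  obtain ⟨v, hv⟩ : ∃ v, L v = 1 := by
    obtain ⟨w, hw⟩ : ∃ w, L w ≠ 0 := by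
      by_contra! h
      exact hL (ContinuousLinearMap.ext h)
    exact ⟨(L w)⁻¹ • w, by simp [hw]⟩
  have hsurj : Function.Surjective (L : EuclideanSpace ℝ (Fin d) →ₗ[ℝ] ℝ) := by
    intro t
    exact ⟨t • v, by simp [hv]⟩
  have hnull : volume (L ⁻¹' N) = 0 := by
    have := (ae_comp_linearMap_mem_iff (L : EuclideanSpace ℝ (Fin d) →ₗ[ℝ] ℝ)
      volume volume hsurj hNm.compl).2 (by rw [ae_iff]; simpa using hN)
    rw [ae_iff] at this
    simp only [Set.mem_compl_iff, not_not] at this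
    exact this
  let Φ : EuclideanSpace ℝ (Fin d) → EuclideanSpace ℝ (Fin d) := fun x => x + (F x - L x) • v
  have hΦ : HasStrictFDerivAt Φ (ContinuousLinearMap.id ℝ (EuclideanSpace ℝ (Fin d))) x₀ := by
    have h1 := (hasStrictFDerivAt_id (𝕜 := ℝ) x₀).add
      ((hF.sub L.hasStrictFDerivAt).smul_const v)
    refine h1.congr_fderiv ?_
    ext y
    simp
  have hLΦ : ∀ x, L (Φ x) = F x := by
    intro x
    simp [Φ, hv]
  have hev := mul_le_addHaar_image_of_lt_det
    (volume : Measure (EuclideanSpace ℝ (Fin d)))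
    (ContinuousLinearMap.id ℝ (EuclideanSpace ℝ (Fin d))) (m := 1/2) (by
      have : (ContinuousLinearMap.id ℝ (EuclideanSpace ℝ (Fin d))).det = 1 := by
        simp [ContinuousLinearMap.det]
      rw [this]
      simp
      )
  obtain ⟨δ, hδ, hδ0⟩ := (hev.and self_mem_nhdsWithin).exists
  obtain ⟨s, hs, happ⟩ := hΦ.approximates_deriv_on_nhds (c := δ) (Or.inr hδ0)
  refine ⟨s, hs, ?_⟩
  have h2 := hδ (s ∩ F ⁻¹' N) Φ (happ.mono_set Set.inter_subset_left)
  have h3 : volume (Φ '' (s ∩ F ⁻¹' N)) = 0 := by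
    refine measure_mono_null ?_ hnull
    rintro _ ⟨x, hx, rfl⟩
    simpa [hLΦ] using hx.2
  rw [h3] at h2
  simpa using h2

lemma aux_null {d : ℕ} {U : Set (EuclideanSpace ℝ (Fin d))} (hU : IsOpen U)
    {F : EuclideanSpace ℝ (Fin d) → ℝ} (hF : ContDiffOn ℝ 1 F U) {N : Set ℝ}
    (hNm : MeasurableSet N) (hN : volume N = 0) :
    volume {x | x ∈ U ∧ gradient F x ≠ 0 ∧ F x ∈ N} = 0 := by
  apply measure_null_of_locally_null
  rintro x ⟨hxU, hx, -⟩
  have hst : HasStrictFDerivAt F (fderiv ℝ F x) x :=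
    (hF.contDiffAt (hU.mem_nhds hxU)).hasStrictFDerivAt (by simp)
  obtain ⟨s, hs, h0⟩ := aux_local hst (by
    intro h
    exact hx (by simp [gradient, h])) hNm hN
  refine ⟨_, inter_mem_nhdsWithin _ hs, measure_mono_null ?_ h0⟩
  rintro y ⟨⟨-, -, hy⟩, hys⟩
  exact ⟨hys, hy⟩

lemma aux_RL (ν : Measure ℝ) [IsFiniteMeasure ν] (hν : ν ≪ volume) :
    Tendsto (fun k : ℝ => ∫ t, Complex.exp (Complex.I * k * t) ∂ν) atTop (𝓝 0) := by
  have h := Real.tendsto_integral_exp_smul_cocompact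
    (fun t => (((ν.rnDeriv volume t).toReal : ℝ) : ℂ))
  have hk : Tendsto (fun k : ℝ => k * (-(2 * Real.pi)⁻¹)) atTop (cocompact ℝ) := by
    have : Tendsto (fun k : ℝ => k * (-(2 * Real.pi)⁻¹)) atTop atBot :=
      tendsto_id.atTop_mul_const_of_neg (by simp [Real.pi_pos])
    exact this.mono_right atBot_le_cocompact
  refine (h.comp hk).congr fun k => ?_
  rw [← integral_rnDeriv_smul hν]
  simp only [Function.comp]
  congr 1 with t
  rw [Circle.smul_def, Real.fourierChar_apply, smul_eq_mul, mul_comm, Complex.real_smul]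
  congr 2
  have : (Real.pi : ℂ) ≠ 0 := by exact_mod_cast Real.pi_ne_zero
  push_cast
  field_simp

lemma aux_pos {α : Type*} [MeasurableSpace α] (μ : Measure α) (F : α → ℝ)
    (hF : AEMeasurable F μ) (hac : μ.map F ≪ volume) (p : α → ℝ) (hp : Measurable p)
    (hp0 : ∀ x, 0 ≤ p x) (hpi : Integrable p μ) :
    Tendsto (fun k : ℝ => ∫ x, (p x : ℂ) * Complex.exp (Complex.I * k * F x) ∂μ)
      atTop (𝓝 0) := by
  let ρ : Measure α := μ.withDensity (fun x => ENNReal.ofReal (p x))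
  have : IsFiniteMeasure ρ := isFiniteMeasure_withDensity_ofReal hpi.2
  have hρ : ρ ≪ μ := withDensity_absolutelyContinuous _ _
  have hFρ : AEMeasurable F ρ := hF.mono_ac hρ
  have hac' : ρ.map F ≪ volume := by
    refine Measure.AbsolutelyContinuous.mk fun s hs h0 => ?_
    rw [Measure.map_apply_of_aemeasurable hFρ hs]
    apply hρ
    rw [← Measure.map_apply_of_aemeasurable hF hs]
    exact hac h0
  refine (aux_RL (ρ.map F) hac').congr fun k => ?_
  rw [integral_map hFρ (by fun_prop)]
  rw [integral_withDensity_eq_integral_toReal_smul (by fun_prop) (by simp)]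
  congr 1 with x
  rw [ENNReal.toReal_ofReal (hp0 x), Complex.real_smul]

lemma aux_int {α : Type*} [MeasurableSpace α] {μ : Measure α} {F : α → ℝ}
    (hF : AEMeasurable F μ) {p : α → ℝ} (hpi : Integrable p μ) (k : ℝ) :
    Integrable (fun x => (p x : ℂ) * Complex.exp (Complex.I * k * F x)) μ := by
  refine hpi.ofReal.mul_bdd (c := 1) (by fun_prop) (ae_of_all _ fun x => ?_)
  rw [Complex.norm_exp]
  simp

/-- **Vanishing of oscillatory integrals with almost-nowhere-stationary phase.**
If `U ⊆ ℝ^d` is open, `F : U → ℝ` is `C¹`, `g : U → ℂ` is continuous with compact support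
contained in `U`, and the set of stationary points of `F` inside the support of `g` has
Lebesgue measure zero, then `∫_U g(x) e^{ikF(x)} dx → 0` as `k → ∞`. -/
theorem stmt13 (d : ℕ) (U : Set (EuclideanSpace ℝ (Fin d))) (hU : IsOpen U)
    (F : EuclideanSpace ℝ (Fin d) → ℝ) (hF : ContDiffOn ℝ 1 F U)
    (g : EuclideanSpace ℝ (Fin d) → ℂ) (hg : Continuous g)
    (hgc : HasCompactSupport g) (hgsupp : tsupport g ⊆ U)
    (hcrit : volume {x | x ∈ tsupport g ∧ gradient F x = 0} = 0) :
    Tendsto (fun k : ℝ => ∫ x in U, g x * Complex.exp (Complex.I * k * F x))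
      atTop (𝓝 0) := by
  have hKm : MeasurableSet (tsupport g) := (isClosed_tsupport g).measurableSet
  have hFm : AEMeasurable F (volume.restrict (tsupport g)) :=
    (hF.continuousOn.mono hgsupp).aemeasurable hKm
  have hac : (volume.restrict (tsupport g)).map F ≪ volume := by
    refine Measure.AbsolutelyContinuous.mk fun s hs h0 => ?_
    rw [Measure.map_apply_of_aemeasurable hFm hs, Measure.restrict_apply' hKm]
    refine measure_mono_null ?_ (measure_union_null hcrit (aux_null hU hF hs h0))
    rintro x ⟨hx, hxK⟩
    by_cases h : gradient F x = 0
    · exact Or.inl ⟨hxK, h⟩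
    · exact Or.inr ⟨hgsupp hxK, h, hx⟩
  have hgi : Integrable g (volume.restrict (tsupport g)) :=
    (hg.integrable_of_hasCompactSupport hgc).restrict
  have key : ∀ q : EuclideanSpace ℝ (Fin d) → ℝ, Continuous q →
      Integrable q (volume.restrict (tsupport g)) →
      Tendsto (fun k : ℝ => ∫ x in tsupport g, (q x : ℂ) * Complex.exp (Complex.I * k * F x))
        atTop (𝓝 0) := by
    intro q hq hqi
    have h1 := aux_pos _ F hFm hac (fun x => max (q x) 0) (by fun_prop)
      (fun x => le_max_right _ _) hqi.pos_part
    have h2 := aux_pos _ F hFm hac (fun x => max (-q x) 0) (by fun_prop)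
      (fun x => le_max_right _ _) hqi.neg_part
    have h3 := h1.sub h2
    rw [sub_zero] at h3
    refine h3.congr fun k => ?_
    rw [← integral_sub]
    · congr 1 with x
      rw [← sub_mul, ← Complex.ofReal_sub]
      congr 2
      rcases le_total 0 (q x) with h | h <;> simp [h]
    · exact aux_int hFm hqi.pos_part k
    · exact aux_int hFm hqi.neg_part k
  have h3 := (key (fun x => (g x).re) (by fun_prop) hgi.re).add
    ((key (fun x => (g x).im) (by fun_prop) hgi.im).const_mul Complex.I)
  rw [mul_zero, add_zero] at h3
  refine h3.congr fun k => ?_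
  rw [← integral_const_mul, ← integral_add (aux_int (p := fun x => (g x).re) hFm hgi.re k)
    ((aux_int (p := fun x => (g x).im) hFm hgi.im k).const_mul _)]
  rw [setIntegral_eq_of_subset_of_forall_diff_eq_zero hU.measurableSet hgsupp]
  · congr 1 with x
    rw [← mul_assoc, ← add_mul]
    congr 1
    conv_rhs => rw [← Complex.re_add_im (g x)]
    rw [mul_comm Complex.I]
  · intro x hx
    rw [image_eq_zero_of_notMem_tsupport hx.2, zero_mul]
end
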